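/- arXiv:1502.07967 — 7 statements merged into one kernel-verified Lean document; each statement's English description precedes it below -/
import Mathlib

section
/- Let n ≥ 1, let F be an n×n complex matrix, let ρ be an n×n complex matrix with ρ† = ρ, and let c ∈ ℂ satisfy Fρ = cρ. Then the dissipator applied to ρ equals a commutator: F ρ F† − ½(F†F ρ + ρ F†F) = −i[A, ρ], where A = (i/2)(c̄ F − c F†); moreover A is Hermitian (A† = A). -/
open Matrix

/-- If `ρ` is Hermitian and `F ρ = c ρ`, then the Lindblad dissipator
applied to `ρ` equals the commutator `-i[A, ρ]` with `A = (i/2)(c̄ F - c F†)`,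
and `A` is Hermitian. -/
theorem dissipator_eq_commutator_of_eigen
    (n : ℕ) (hn : 1 ≤ n) (F ρ : Matrix (Fin n) (Fin n) ℂ) (c : ℂ)
    (hherm : ρᴴ = ρ) (heig : F * ρ = c • ρ) :
    F * ρ * Fᴴ - (1/2 : ℂ) • (Fᴴ * F * ρ + ρ * (Fᴴ * F)) =
      (-Complex.I) • (((Complex.I / 2) • ((starRingEnd ℂ c) • F - c • Fᴴ)) * ρ
        - ρ * ((Complex.I / 2) • ((starRingEnd ℂ c) • F - c • Fᴴ)))
    ∧ ((Complex.I / 2) • ((starRingEnd ℂ c) • F - c • Fᴴ))ᴴ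
        = (Complex.I / 2) • ((starRingEnd ℂ c) • F - c • Fᴴ) := by
  have heig_adj : ρ * Fᴴ = starRingEnd ℂ c • ρ := by
    simpa [conjTranspose_mul, conjTranspose_smul, hherm] using congrArg conjTranspose heig
  constructor
  · have hleft : Fᴴ * F * ρ = c • (Fᴴ * ρ) := by rw [mul_assoc, heig, Matrix.mul_smul]
    have hright : ρ * (Fᴴ * F) = starRingEnd ℂ c • (ρ * F) := by
      rw [← mul_assoc, heig_adj, Matrix.smul_mul]
    rw [hleft, hright, heig, Matrix.smul_mul, heig_adj]
    simp only [Matrix.smul_mul, Matrix.mul_smul, Matrix.sub_mul, Matrix.mul_sub, heig, heig_adj]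
    ext i j
    simp only [Matrix.sub_apply, Matrix.add_apply, Matrix.smul_apply, smul_eq_mul]
    linear_combination ((1 / 2) * (2 * c * starRingEnd ℂ c * ρ i j
      - c * (Fᴴ * ρ) i j - starRingEnd ℂ c * (ρ * F) i j)) * Complex.I_sq
  · ext i j
    simp only [conjTranspose_apply, Matrix.sub_apply, Matrix.smul_apply, smul_eq_mul,
      star_mul', star_sub, star_div₀, RCLike.star_def, Complex.conj_I, Complex.conj_conj, map_ofNat]
    ring
end

section
/- Let n ≥ 1, let K be a finite index set, let γ_α ≥ 0 for α ∈ K, let H, F_α : ℝ → Matrix (Fin n) (Fin n) ℂ, and let ρ : ℝ → Matrix (Fin n) (Fin n) ℂ be differentiable and satisfy the Lindblad master equation ρ'(t) = −i[H(t), ρ(t)] + Σ_α γ_α (F_α(t) ρ(t) F_α(t)† − ½(F_α(t)†F_α(t) ρ(t) + ρ(t) F_α(t)†F_α(t))) for all t. Suppose further that for every t, ρ(t) is Hermitian (ρ(t)† = ρ(t)) and there exist scalars c_α(t) ∈ ℂ with F_α(t) ρ(t) = c_α(t) ρ(t) for every α ∈ K. Then the purity t ↦ Tr(ρ(t)²)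 is constant on ℝ. -/
open Matrix

/-- The derivative of the trace of the square of a matrix-valued function. -/
theorem hasDerivAt_trace_mul_self {ι : Type*} [Fintype ι] {ρ : ℝ → Matrix ι ι ℂ}
    {ρ' : Matrix ι ι ℂ} {t : ℝ} (h : ∀ i j, HasDerivAt (fun s => ρ s i j) (ρ' i j) t) :
    HasDerivAt (fun s => (ρ s * ρ s).trace) (2 * (ρ' * ρ t).trace) t := by
  have key : HasDerivAt (fun s => ∑ i, ∑ j, ρ s i j * ρ s j i)
      (∑ i, ∑ j, (ρ' i j * ρ t j i + ρ t i j * ρ' j i)) t :=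
    HasDerivAt.fun_sum fun i _ => HasDerivAt.fun_sum fun j _ => (h i j).mul (h j i)
  have hval : 2 * (ρ' * ρ t).trace = (ρ' * ρ t).trace + (ρ t * ρ').trace := by
    rw [trace_mul_comm (ρ t), two_mul]
  rw [hval]
  simpa only [trace, diag_apply, mul_apply, Finset.sum_add_distrib] using key

theorem trace_commutator_mul_self {ι R : Type*} [Fintype ι] [CommRing R] (A B : Matrix ι ι R) :
    ((A * B - B * A) * B).trace = 0 := by
  rw [sub_mul, trace_sub, trace_mul_cycle B A B, trace_mul_cycle B B A, sub_self]

/-- The dissipator of a Lindblad operator is trace-orthogonal to its Hermitian eigenmatrices. -/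
theorem trace_dissipator_mul_self {ι : Type*} [Fintype ι] {F ρ : Matrix ι ι ℂ} {c : ℂ}
    (hρ : ρᴴ = ρ) (h : F * ρ = c • ρ) :
    ((F * ρ * Fᴴ - (1 / 2 : ℂ) • (Fᴴ * F * ρ + ρ * (Fᴴ * F))) * ρ).trace = 0 := by
  have h' : ρ * Fᴴ = star c • ρ := by
    rw [← conjTranspose_inj, conjTranspose_mul, conjTranspose_conjTranspose, hρ, h,
      conjTranspose_smul, star_star, hρ]
  have h₁ : (F * ρ * Fᴴ * ρ).trace = c * star c * (ρ * ρ).trace := by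
    rw [h, smul_mul_assoc, h', smul_mul_assoc, smul_mul_assoc, trace_smul, trace_smul,
      smul_eq_mul, smul_eq_mul, mul_assoc]
  have h₂ : (ρ * (Fᴴ * F) * ρ).trace = c * star c * (ρ * ρ).trace := by
    rw [← Matrix.mul_assoc, h', Matrix.mul_assoc, h, mul_smul_comm, smul_mul_assoc, trace_smul,
      trace_smul, smul_eq_mul, smul_eq_mul, mul_assoc]
  have h₃ : (Fᴴ * F * ρ * ρ).trace = (ρ * (Fᴴ * F) * ρ).trace := by
    rw [trace_mul_comm, Matrix.mul_assoc ρ]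
  rw [sub_mul, trace_sub, smul_mul_assoc, trace_smul, add_mul, trace_add, h₃, h₂, h₁, smul_eq_mul]
  ring

/-- A solution of the Lindblad master equation which is at each instant
a Hermitian simultaneous eigenmatrix of all Lindblad operators has constant purity. -/
theorem purity_const_of_lindblad_eigenstate
    (n : ℕ) (hn : 1 ≤ n) (K : Type) [Fintype K]
    (γ : K → ℝ) (hγ : ∀ α, 0 ≤ γ α)
    (H : ℝ → Matrix (Fin n) (Fin n) ℂ)
    (F : K → ℝ → Matrix (Fin n) (Fin n) ℂ)
    (ρ : ℝ → Matrix (Fin n) (Fin n) ℂ)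
    (hdyn : ∀ (t : ℝ) (i j : Fin n), HasDerivAt (fun s => ρ s i j)
      (((-Complex.I) • (H t * ρ t - ρ t * H t)
        + ∑ α : K, (γ α : ℂ) • (F α t * ρ t * (F α t)ᴴ
          - (1/2 : ℂ) • ((F α t)ᴴ * F α t * ρ t + ρ t * ((F α t)ᴴ * F α t)))) i j) t)
    (hherm : ∀ t, (ρ t)ᴴ = ρ t)
    (heig : ∀ (t : ℝ) (α : K), ∃ c : ℂ, F α t * ρ t = c • ρ t) :
    ∀ s t : ℝ, (ρ s * ρ s).trace = (ρ t * ρ t).trace := by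
  have hderiv : ∀ t, HasDerivAt (fun s => (ρ s * ρ s).trace) 0 t := by
    intro t
    convert hasDerivAt_trace_mul_self (hdyn t) using 1
    have hdiss : ∀ α, ((F α t * ρ t * (F α t)ᴴ
        - (1/2 : ℂ) • ((F α t)ᴴ * F α t * ρ t + ρ t * ((F α t)ᴴ * F α t))) * ρ t).trace = 0 :=
      fun α => (heig t α).elim fun _ h => trace_dissipator_mul_self (hherm t) h
    simp only [add_mul _ _ (ρ t), Finset.sum_mul, smul_mul_assoc _ _ (ρ t), trace_add, trace_sum,
      trace_smul, trace_commutator_mul_self, hdiss, smul_zero, Finset.sum_const_zero, add_zero,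
      mul_zero]
  exact is_const_of_deriv_eq_zero (fun t => (hderiv t).differentiableAt) fun t => (hderiv t).deriv
end

section
/- Let n ≥ 1, let ψ ∈ ℂⁿ be a unit vector, set ρ = ψψ†, let K be a finite index set, let γ_α > 0, and F_α ∈ Matrix (Fin n) (Fin n) ℂ for α ∈ K, and let 𝓛_D ρ = Σ_α γ_α (F_α ρ F_α† − ½{F_α†F_α, ρ}). Then Tr(ρ · 𝓛_D ρ) = 0 if and only if for every α ∈ K, ψ is an eigenvector of F_α with F_α ψ = ⟨ψ, F_α ψ⟩ ψ. -/
open Matrix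

/-- The Lindblad dissipator `𝓛_D ρ = Σ_α γ_α (F_α ρ F_α† − ½{F_α†F_α, ρ})`. -/
noncomputable def lindbladDissipator {n : ℕ} {K : Type} [Fintype K] (γ : K → ℝ)
    (F : K → Matrix (Fin n) (Fin n) ℂ) (ρ : Matrix (Fin n) (Fin n) ℂ) :
    Matrix (Fin n) (Fin n) ℂ :=
  ∑ α : K, (γ α : ℂ) • (F α * ρ * (F α)ᴴ
    - (1/2 : ℂ) • ((F α)ᴴ * F α * ρ + ρ * ((F α)ᴴ * F α)))

/-- The expectation value of `A` in the state `ψψ†`, as a trace. -/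
lemma trace_vecMulVec_star_mul {n : ℕ} (ψ : Fin n → ℂ) (A : Matrix (Fin n) (Fin n) ℂ) :
    (vecMulVec ψ (star ψ) * A).trace = star ψ ⬝ᵥ (A *ᵥ ψ) := by
  rw [vecMulVec_mul, trace_vecMulVec, dotProduct_comm, ← dotProduct_mulVec]

/-- The contribution of a single Lindblad operator `A` to `Tr(ρ 𝓛_D ρ)` at a pure state
is minus the variance of `A`. -/
lemma trace_vecMulVec_star_mul_dissipator_term {n : ℕ} {ψ : Fin n → ℂ} (hψ : star ψ ⬝ᵥ ψ = 1)
    (A : Matrix (Fin n) (Fin n) ℂ) :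
    (vecMulVec ψ (star ψ) * (A * vecMulVec ψ (star ψ) * Aᴴ
      - (1/2 : ℂ) • (Aᴴ * A * vecMulVec ψ (star ψ) + vecMulVec ψ (star ψ) * (Aᴴ * A)))).trace
      = -(star (A *ᵥ ψ - (star ψ ⬝ᵥ (A *ᵥ ψ)) • ψ) ⬝ᵥ
          (A *ᵥ ψ - (star ψ ⬝ᵥ (A *ᵥ ψ)) • ψ)) := by
  have hadj (v : Fin n → ℂ) : star ψ ⬝ᵥ (Aᴴ *ᵥ v) = star (A *ᵥ ψ) ⬝ᵥ v := by
    rw [dotProduct_mulVec, star_mulVec]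
  have hproj (v : Fin n → ℂ) : vecMulVec ψ (star ψ) *ᵥ v = (star ψ ⬝ᵥ v) • ψ := by
    rw [vecMulVec_mulVec, op_smul_eq_smul]
  have hstar : star (star ψ ⬝ᵥ (A *ᵥ ψ)) = star (A *ᵥ ψ) ⬝ᵥ ψ := by
    rw [star_dotProduct, star_star]
  rw [trace_vecMulVec_star_mul]
  simp only [sub_mulVec, smul_mulVec, add_mulVec, ← mulVec_mulVec, hproj, mulVec_smul, hadj,
    dotProduct_sub, dotProduct_add, dotProduct_smul, sub_dotProduct, smul_dotProduct, star_sub,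
    star_smul, hψ, hstar, smul_eq_mul]
  ring

/-- For a pure state `ρ = ψψ†` with `ψ` a unit vector and strictly positive
rates, `Tr(ρ 𝓛_D ρ) = 0` iff `ψ` is an eigenvector of each `F_α`, with
`F_α ψ = ⟨ψ, F_α ψ⟩ ψ`. -/
theorem trace_pure_mul_dissipator_eq_zero_iff
    (n : ℕ) (hn : 1 ≤ n) (ψ : Fin n → ℂ) (hψ : star ψ ⬝ᵥ ψ = 1)
    (K : Type) [Fintype K] (γ : K → ℝ) (hγ : ∀ α, 0 < γ α)
    (F : K → Matrix (Fin n) (Fin n) ℂ) :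
    (vecMulVec ψ (star ψ) *
        lindbladDissipator γ F (vecMulVec ψ (star ψ))).trace = 0
      ↔ ∀ α : K, (F α) *ᵥ ψ = (star ψ ⬝ᵥ ((F α) *ᵥ ψ)) • ψ := by
  have htrace : (vecMulVec ψ (star ψ) *
      lindbladDissipator γ F (vecMulVec ψ (star ψ))).trace
      = -∑ α, (γ α : ℂ) * (star (F α *ᵥ ψ - (star ψ ⬝ᵥ (F α *ᵥ ψ)) • ψ) ⬝ᵥ
          (F α *ᵥ ψ - (star ψ ⬝ᵥ (F α *ᵥ ψ)) • ψ)) := by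
    simp only [lindbladDissipator, Finset.mul_sum, trace_sum, Matrix.mul_smul, trace_smul,
      trace_vecMulVec_star_mul_dissipator_term hψ, smul_eq_mul, mul_neg, Finset.sum_neg_distrib]
  open scoped ComplexOrder in
  rw [htrace, neg_eq_zero, Finset.sum_eq_zero_iff_of_nonneg fun α _ =>
    mul_nonneg (Complex.zero_le_real.2 (hγ α).le) (dotProduct_star_self_nonneg _)]
  simp only [Finset.mem_univ, true_imp_iff, mul_eq_zero, Complex.ofReal_eq_zero, (hγ _).ne',
    false_or, dotProduct_star_self_eq_zero, sub_eq_zero]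
end

section
/- In the setting of moving orthonormal frames {Φ_j(t)} (j = 1,…,M) and {Φ_m^⊥(t)} (m = 1,…,N−M) forming an orthonormal basis of ℂᴺ for each t, with U(t) = Σ_j Φ_j(0)Φ_j(t)† + Σ_m Φ_m^⊥(0)Φ_m^⊥(t)† and G(t) = i U(t)†U'(t), let K be a finite index set, γ_α ≥ 0, F_α(t), H(t) ∈ Matrix (Fin N) (Fin N) ℂ, c_α(t) ∈ ℂ, and suppose F_α(t) Φ_k(t) = c_α(t) Φ_k(t) for all α and all k = 1,…,M. Define H_eff(t) = G(t) + H(t) + (i/2) Σ_α γ_α (c̄_α(t) F_α(t) − c_α(t) F_α(t)†). Then for fixed t, k, m, the matrix element ⟨Φ_k(t), H_eff(t) Φ_m^⊥(t)⟩ vanishes if and only if ⟨Φ_k(t), H(t) Φ_m^⊥(t)⟩ = −i ⟨Φ_k'(t), Φ_m^⊥(t)⟩ − (i/2) Σ_α γ_α c̄_α(t) ⟨Φ_k(t), F_α(t) Φ_m^⊥(t)⟩. -/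
open Matrix

/-- The rows of the transport matrix: pairing its left factor `Φ k` on the left picks out the
right factor `star (Φ' k)`. -/
theorem star_vecMul_frame_transport {ι κ n : Type*} [Fintype ι] [Fintype κ] [Fintype n]
    [DecidableEq ι] (Φ Φ' : ι → n → ℂ) (Ψ Ψ' : κ → n → ℂ)
    (hΦ : ∀ j k, star (Φ j) ⬝ᵥ Φ k = if j = k then 1 else 0)
    (hΦΨ : ∀ j m, star (Φ j) ⬝ᵥ Ψ m = 0) (k : ι) :
    star (Φ k) ᵥ* (∑ j, vecMulVec (Φ j) (star (Φ' j)) + ∑ m, vecMulVec (Ψ m) (star (Ψ' m)))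
      = star (Φ' k) := by
  simp [vecMul_add, vecMul_sum, vecMul_vecMulVec, hΦ, hΦΨ]

/-- The transport matrix sends `Φ' k` to `Φ k`. -/
theorem frame_transport_mulVec {ι κ n : Type*} [Fintype ι] [Fintype κ] [Fintype n]
    [DecidableEq ι] (Φ Φ' : ι → n → ℂ) (Ψ Ψ' : κ → n → ℂ)
    (hΦ : ∀ j k, star (Φ' j) ⬝ᵥ Φ' k = if j = k then 1 else 0)
    (hΦΨ : ∀ j m, star (Φ' j) ⬝ᵥ Ψ' m = 0) (k : ι) :
    (∑ j, vecMulVec (Φ j) (star (Φ' j)) + ∑ m, vecMulVec (Ψ m) (star (Ψ' m))) *ᵥ Φ' k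
      = Φ k := by
  have hΨΦ (m : κ) : star (Ψ' m) ⬝ᵥ Φ' k = 0 := by
    rw [← star_star (star (Ψ' m) ⬝ᵥ Φ' k), star_dotProduct, star_star, hΦΨ, star_zero]
  simp [add_mulVec, sum_mulVec, vecMulVec_mulVec, hΦ, hΨΦ]

/-- Entrywise differentiation of a constant row vector times a matrix curve. -/
theorem hasDerivAt_vecMul_apply {m n : Type*} [Fintype m] (v : m → ℂ) {A : ℝ → Matrix m n ℂ}
    {A' : Matrix m n ℂ} {t : ℝ} (hA : ∀ i j, HasDerivAt (fun s => A s i j) (A' i j) t) (j : n) :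
    HasDerivAt (fun s => (v ᵥ* A s) j) ((v ᵥ* A') j) t := by
  simp only [vecMul, dotProduct]
  exact HasDerivAt.fun_sum fun i _ => (hA i j).const_mul (v i)

/-- The adjoint of a matrix moves to the left slot of the inner product. -/
theorem star_dotProduct_conjTranspose_mulVec {m n : Type*} [Fintype m] [Fintype n]
    (A : Matrix m n ℂ) (x : n → ℂ) (y : m → ℂ) :
    star x ⬝ᵥ (Aᴴ *ᵥ y) = star (A *ᵥ x) ⬝ᵥ y := by
  rw [star_mulVec, dotProduct_mulVec]

/-- With moving orthonormal frames, `U(t)`, `G(t) = iU(t)†U'(t)` as in the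
t-DFS theorem, and Lindblad operators `F_α(t)` admitting the frame vectors `Φ_k(t)` as
eigenvectors with eigenvalues `c_α(t)`, the invariance matrix element
`⟨Φ_k(t), H_eff(t) Φ_m^⊥(t)⟩` vanishes iff
`⟨Φ_k(t), H(t) Φ_m^⊥(t)⟩ = −i⟨Φ_k'(t), Φ_m^⊥(t)⟩
  − (i/2) Σ_α γ_α c̄_α(t) ⟨Φ_k(t), F_α(t) Φ_m^⊥(t)⟩`. -/
theorem heff_matrix_element_vanishes_iff
    (N M : ℕ) (hN : 1 ≤ N) (hM : 1 ≤ M) (hMN : M ≤ N)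
    (Φ Φ' : Fin M → ℝ → Fin N → ℂ)
    (Ψ Ψ' : Fin (N - M) → ℝ → Fin N → ℂ)
    (hΦ : ∀ (j : Fin M) (i : Fin N) (t : ℝ),
      HasDerivAt (fun s => Φ j s i) (Φ' j t i) t)
    (hΨ : ∀ (m : Fin (N - M)) (i : Fin N) (t : ℝ),
      HasDerivAt (fun s => Ψ m s i) (Ψ' m t i) t)
    (horth₁ : ∀ (t : ℝ) (j k : Fin M),
      star (Φ j t) ⬝ᵥ Φ k t = if j = k then 1 else 0)
    (horth₂ : ∀ (t : ℝ) (m l : Fin (N - M)),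
      star (Ψ m t) ⬝ᵥ Ψ l t = if m = l then 1 else 0)
    (horth₃ : ∀ (t : ℝ) (j : Fin M) (m : Fin (N - M)),
      star (Φ j t) ⬝ᵥ Ψ m t = 0)
    (U Udot G : ℝ → Matrix (Fin N) (Fin N) ℂ)
    (hU : ∀ t, U t = ∑ j : Fin M, vecMulVec (Φ j 0) (star (Φ j t))
      + ∑ m : Fin (N - M), vecMulVec (Ψ m 0) (star (Ψ m t)))
    (hUdot : ∀ (t : ℝ) (i j : Fin N),
      HasDerivAt (fun s => U s i j) (Udot t i j) t)
    (hG : ∀ t, G t = Complex.I • ((U t)ᴴ * Udot t))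
    (K : Type) [Fintype K] (γ : K → ℝ) (hγ : ∀ α, 0 ≤ γ α)
    (F : K → ℝ → Matrix (Fin N) (Fin N) ℂ)
    (H : ℝ → Matrix (Fin N) (Fin N) ℂ)
    (c : K → ℝ → ℂ)
    (heig : ∀ (α : K) (t : ℝ) (k : Fin M),
      (F α t) *ᵥ (Φ k t) = c α t • Φ k t)
    (Heff : ℝ → Matrix (Fin N) (Fin N) ℂ)
    (hHeff : ∀ t, Heff t = G t + H t
      + (Complex.I / 2) • ∑ α : K, (γ α : ℂ) •
          ((starRingEnd ℂ (c α t)) • F α t - c α t • (F α t)ᴴ)) :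
    ∀ (t : ℝ) (k : Fin M) (m : Fin (N - M)),
      star (Φ k t) ⬝ᵥ ((Heff t) *ᵥ (Ψ m t)) = 0
        ↔ star (Φ k t) ⬝ᵥ ((H t) *ᵥ (Ψ m t))
            = (-Complex.I) * (star (Φ' k t) ⬝ᵥ Ψ m t)
              - (Complex.I / 2) * ∑ α : K, (γ α : ℂ) * (starRingEnd ℂ (c α t))
                  * (star (Φ k t) ⬝ᵥ ((F α t) *ᵥ (Ψ m t))) := by
  intro t k m
  have hrow (s : ℝ) : star (Φ k 0) ᵥ* U s = star (Φ k s) := by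
    rw [hU]
    exact star_vecMul_frame_transport (Φ · 0) (Φ · s) (Ψ · 0) (Ψ · s) (horth₁ 0) (horth₃ 0) k
  have hrow' : star (Φ k 0) ᵥ* Udot t = star (Φ' k t) := by
    funext i
    have h := hasDerivAt_vecMul_apply (star (Φ k 0)) (hUdot t) i
    simp only [hrow] at h
    exact h.unique (hΦ k i t).star
  have hcol : U t *ᵥ Φ k t = Φ k 0 := by
    rw [hU]
    exact frame_transport_mulVec (Φ · 0) (Φ · t) (Ψ · 0) (Ψ · t) (horth₁ t) (horth₃ t) k
  have hGel : star (Φ k t) ⬝ᵥ (G t *ᵥ Ψ m t) = Complex.I * (star (Φ' k t) ⬝ᵥ Ψ m t) := by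
    rw [hG, smul_mulVec, dotProduct_smul, ← mulVec_mulVec,
      star_dotProduct_conjTranspose_mulVec, hcol, dotProduct_mulVec, hrow', smul_eq_mul]
  have hF (α : K) : star (Φ k t) ⬝ᵥ ((F α t)ᴴ *ᵥ Ψ m t) = 0 := by
    rw [star_dotProduct_conjTranspose_mulVec, heig, star_smul, smul_dotProduct, horth₃,
      smul_zero]
  have hel : star (Φ k t) ⬝ᵥ (Heff t *ᵥ Ψ m t)
      = Complex.I * (star (Φ' k t) ⬝ᵥ Ψ m t) + star (Φ k t) ⬝ᵥ (H t *ᵥ Ψ m t)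
        + (Complex.I / 2) * ∑ α : K, (γ α : ℂ) * (starRingEnd ℂ (c α t))
          * (star (Φ k t) ⬝ᵥ (F α t *ᵥ Ψ m t)) := by
    simp only [hHeff, add_mulVec, sub_mulVec, smul_mulVec, sum_mulVec, dotProduct_add,
      dotProduct_sub, dotProduct_smul, dotProduct_sum, hGel, hF, smul_eq_mul, mul_zero, sub_zero,
      mul_assoc]
  rw [hel]
  constructor <;> intro h <;> linear_combination h
end

section
/- Let n ≥ 1, let H, F : ℝ → Matrix (Fin n) (Fin n) ℂ with H(t) Hermitian for every t, let γ ≥ 0, let c : ℝ → ℂ, and let ψ : ℝ → ℂⁿ be differentiable with ‖ψ(0)‖ = 1, satisfying for all t: (i) F(t) ψ(t) = c(t) ψ(t), and (ii) ψ'(t) = −i (H(t) + A(t)) ψ(t), where A(t) = (iγ/2)(c̄(t) F(t) − c(t) F(t)†). Then ‖ψ(t)‖ = 1 for all t, and ρ(t) := ψ(t)ψ(t)† solves the Lindblad master equation ρ'(t) = −i[H(t), ρ(t)] + γ (F(t) ρ(t) F(t)† − ½(F(t)†F(t) ρ(t) + ρ(t) F(t)†F(t))); in particular Tr(ρ(t)²)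 = 1 for all t. -/
open Matrix

/-- The Schrödinger equation with Hermitian generator `K` makes the projection `ψψ†` satisfy the
von Neumann equation. -/
theorem hasDerivAt_vecMulVec_star_of_schrodinger {ι : Type*} [Fintype ι]
    {K : Matrix ι ι ℂ} (hK : K.IsHermitian) {ψ : ℝ → ι → ℂ} {t : ℝ}
    (h : ∀ i, HasDerivAt (fun s => ψ s i) (((-Complex.I) • (K *ᵥ ψ t)) i) t) (i j : ι) :
    HasDerivAt (fun s => vecMulVec (ψ s) (star (ψ s)) i j)
      (((-Complex.I) • (K * vecMulVec (ψ t) (star (ψ t))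
        - vecMulVec (ψ t) (star (ψ t)) * K)) i j) t := by
  have hstar : star (ψ t) ᵥ* K = star (K *ᵥ ψ t) := by
    rw [star_mulVec, hK.eq]
  rw [mul_vecMulVec, vecMulVec_mul, hstar]
  refine ((h i).mul (h j).star).congr_deriv ?_
  simp [vecMulVec_apply]
  ring

/-- The norm is preserved by the Schrödinger equation with Hermitian generator. -/
theorem star_dotProduct_self_eq_of_schrodinger {ι : Type*} [Fintype ι]
    {K : ℝ → Matrix ι ι ℂ} (hK : ∀ t, (K t).IsHermitian) {ψ : ℝ → ι → ℂ}
    (h : ∀ t i, HasDerivAt (fun s => ψ s i) (((-Complex.I) • (K t *ᵥ ψ t)) i) t) (s t : ℝ) :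
    star (ψ s) ⬝ᵥ ψ s = star (ψ t) ⬝ᵥ ψ t := by
  have hderiv (r : ℝ) : HasDerivAt (fun s => star (ψ s) ⬝ᵥ ψ s) 0 r := by
    have hsum := HasDerivAt.fun_sum (u := Finset.univ) fun i _ =>
      hasDerivAt_vecMulVec_star_of_schrodinger (hK r) (h r) i i
    refine (hsum.congr_deriv ?_).congr_of_eventuallyEq (.of_forall fun s => ?_)
    · change trace ((-Complex.I) • (K r * vecMulVec (ψ r) (star (ψ r))
        - vecMulVec (ψ r) (star (ψ r)) * K r)) = 0
      rw [trace_smul, trace_sub, trace_mul_comm, sub_self, smul_zero]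
    · simp [dotProduct, vecMulVec_apply, mul_comm]
  exact is_const_of_deriv_eq_zero (fun r => (hderiv r).differentiableAt)
    (fun r => (hderiv r).deriv) s t

/-- The operator `(iγ/2)(c̄F − cF†)` is Hermitian. -/
theorem isHermitian_smul_conj_smul_sub_smul_conjTranspose {ι : Type*}
    (F : Matrix ι ι ℂ) (γ : ℝ) (c : ℂ) :
    (((Complex.I * (γ : ℂ)) / 2) • ((starRingEnd ℂ c) • F - c • Fᴴ)).IsHermitian := by
  ext i j
  simp
  ring

/-- On the projection onto an eigenvector of `F`, the Lindblad dissipator acts as the commutator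
with `(iγ/2)(c̄F − cF†)`. -/
theorem commutator_eq_dissipator_of_mulVec_eq_smul {ι : Type*} [Fintype ι]
    {F : Matrix ι ι ℂ} {c : ℂ} {v : ι → ℂ} (hv : F *ᵥ v = c • v) (γ : ℝ)
    {A : Matrix ι ι ℂ}
    (hA : A = ((Complex.I * (γ : ℂ)) / 2) • ((starRingEnd ℂ c) • F - c • Fᴴ)) :
    (-Complex.I) • (A * vecMulVec v (star v) - vecMulVec v (star v) * A)
      = (γ : ℂ) • (F * vecMulVec v (star v) * Fᴴ
        - (1/2 : ℂ) • (Fᴴ * F * vecMulVec v (star v)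
          + vecMulVec v (star v) * (Fᴴ * F))) := by
  have hleft : F * vecMulVec v (star v) = c • vecMulVec v (star v) := by
    rw [mul_vecMulVec, hv, smul_vecMulVec]
  have hright : vecMulVec v (star v) * Fᴴ = starRingEnd ℂ c • vecMulVec v (star v) := by
    rw [vecMulVec_mul, ← star_mulVec, hv, star_smul, vecMulVec_smul, starRingEnd_apply]
  generalize vecMulVec v (star v) = ρ at hleft hright ⊢
  rw [Matrix.mul_assoc Fᴴ F, ← Matrix.mul_assoc ρ, hleft, hright, hA]
  simp only [Matrix.smul_mul, Matrix.mul_smul, Matrix.sub_mul, Matrix.mul_sub, hleft, hright]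
  ext i j
  simp only [Matrix.smul_apply, Matrix.sub_apply, Matrix.add_apply, smul_eq_mul]
  linear_combination (-(γ : ℂ) / 2 * (2 * c * starRingEnd ℂ c * ρ i j
    - c * (Fᴴ * ρ) i j - starRingEnd ℂ c * (ρ * F) i j)) * Complex.I_sq

/-- If `ψ(t)` starts as a unit vector, remains an eigenvector of the
Lindblad operator `F(t)` (with eigenvalue `c(t)`), and is driven by the Hermitian
effective Hamiltonian `H(t) + A(t)` with `A = (iγ/2)(c̄ F − c F†)`, then `ψ(t)` stays
normalized, `ρ = ψψ†` solves the Lindblad master equation, and the purity is 1. -/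
theorem dfs_engineering_pure_state
    (n : ℕ) (hn : 1 ≤ n)
    (H F : ℝ → Matrix (Fin n) (Fin n) ℂ)
    (hH : ∀ t, (H t)ᴴ = H t)
    (γ : ℝ) (hγ : 0 ≤ γ)
    (c : ℝ → ℂ) (ψ : ℝ → Fin n → ℂ)
    (hψ0 : star (ψ 0) ⬝ᵥ ψ 0 = 1)
    (heig : ∀ t, (F t) *ᵥ (ψ t) = c t • ψ t)
    (A : ℝ → Matrix (Fin n) (Fin n) ℂ)
    (hA : ∀ t, A t = ((Complex.I * (γ : ℂ)) / 2) •
      ((starRingEnd ℂ (c t)) • F t - c t • (F t)ᴴ))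
    (hdyn : ∀ (t : ℝ) (i : Fin n), HasDerivAt (fun s => ψ s i)
      (((-Complex.I) • ((H t + A t) *ᵥ (ψ t))) i) t) :
    (∀ t, star (ψ t) ⬝ᵥ ψ t = 1)
    ∧ (∀ (t : ℝ) (i j : Fin n), HasDerivAt
        (fun s => vecMulVec (ψ s) (star (ψ s)) i j)
        (((-Complex.I) • (H t * vecMulVec (ψ t) (star (ψ t))
            - vecMulVec (ψ t) (star (ψ t)) * H t)
          + (γ : ℂ) • (F t * vecMulVec (ψ t) (star (ψ t)) * (F t)ᴴ
            - (1/2 : ℂ) • ((F t)ᴴ * F t * vecMulVec (ψ t) (star (ψ t))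
              + vecMulVec (ψ t) (star (ψ t)) * ((F t)ᴴ * F t)))) i j) t)
    ∧ (∀ t : ℝ, (vecMulVec (ψ t) (star (ψ t)) * vecMulVec (ψ t) (star (ψ t))).trace
        = 1) := by
  have hHA (t : ℝ) : (H t + A t).IsHermitian := by
    rw [hA]
    exact IsHermitian.add (hH t) (isHermitian_smul_conj_smul_sub_smul_conjTranspose _ _ _)
  have hnorm (t : ℝ) : star (ψ t) ⬝ᵥ ψ t = 1 :=
    (star_dotProduct_self_eq_of_schrodinger hHA hdyn t 0).trans hψ0
  refine ⟨hnorm, fun t i j => ?_, fun t => ?_⟩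
  · rw [← commutator_eq_dissipator_of_mulVec_eq_smul (heig t) γ (hA t)]
    refine (hasDerivAt_vecMulVec_star_of_schrodinger (hHA t) (hdyn t) i j).congr_deriv ?_
    simp only [Matrix.add_mul, Matrix.mul_add, Matrix.smul_apply, Matrix.sub_apply,
      Matrix.add_apply, smul_eq_mul]
    ring
  · rw [vecMulVec_mul_vecMulVec, hnorm, one_smul, trace_vecMulVec, dotProduct_comm, hnorm]
end

section
/- Let γ ≥ 0, let r, θ : ℝ → ℝ be differentiable with r(t) > 0 for all t, define the unit vector ψ(t) = e^{−r(t)/2} (√(cosh r(t)) e₀ + e^{iθ(t)/2} √(sinh r(t)) e₁) ∈ ℂ² and the Lindblad operator L(t) = cosh(r(t)) e^{−iθ(t)/2} σ₋ + sinh(r(t)) e^{iθ(t)/2} σ₊. Then there exists a function Ω : ℝ → ℂ such that, with H(t) = Ω(t) e₀e₁† + Ω̄(t) e₁e₀† (a Hermitian Hamiltonian with zero diagonal), the projection ρ(t) = ψ(t)ψ(t)† solves the Lindblad master equation ρ'(t) = −i[H(t), ρ(t)] + γ (L(t) ρ(t) L(t)† − ½{L(t)†L(t), ρ(t)}) for all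 t; consequently Tr(ρ(t)²) = 1 for all t. -/
open Matrix

/-- The lowering operator `σ₋ = e₀e₁†`. -/
def sigmaMinus : Matrix (Fin 2) (Fin 2) ℂ := !![0, 1; 0, 0]

/-- The raising operator `σ₊ = e₁e₀†`. -/
def sigmaPlus : Matrix (Fin 2) (Fin 2) ℂ := !![0, 0; 1, 0]

/-- The squeezed-vacuum Lindblad operator
`L(r,θ) = cosh(r) e^{−iθ/2} σ₋ + sinh(r) e^{iθ/2} σ₊`. -/
noncomputable def squeezedL (r θ : ℝ) : Matrix (Fin 2) (Fin 2) ℂ :=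
  ((Real.cosh r : ℂ) * Complex.exp (-(Complex.I * θ) / 2)) • sigmaMinus
    + ((Real.sinh r : ℂ) * Complex.exp ((Complex.I * θ) / 2)) • sigmaPlus

/-- The normalized eigenvector
`ψ = e^{−r/2}(√(cosh r) e₀ + e^{iθ/2} √(sinh r) e₁)` of `L(r,θ)`. -/
noncomputable def dfsState (r θ : ℝ) : Fin 2 → ℂ :=
  ![(Real.exp (-r / 2) : ℂ) * (Real.sqrt (Real.cosh r) : ℂ),
    (Real.exp (-r / 2) : ℂ) * Complex.exp ((Complex.I * θ) / 2)
      * (Real.sqrt (Real.sinh r) : ℂ)]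

theorem conj_exp_I_mul_half (θ : ℝ) :
    starRingEnd ℂ (Complex.exp ((Complex.I * θ) / 2)) = Complex.exp (-(Complex.I * θ) / 2) := by
  rw [← Complex.exp_conj]
  simp [Complex.conj_ofNat]

theorem conj_exp_neg_I_mul_half (θ : ℝ) :
    starRingEnd ℂ (Complex.exp (-(Complex.I * θ) / 2)) = Complex.exp ((Complex.I * θ) / 2) := by
  rw [← conj_exp_I_mul_half, Complex.conj_conj]

theorem exp_I_mul_half_mul_exp_neg (θ : ℝ) :
    Complex.exp ((Complex.I * θ) / 2) * Complex.exp (-(Complex.I * θ) / 2) = 1 := by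
  rw [← Complex.exp_add, neg_div, add_neg_cancel, Complex.exp_zero]

/-- The projection onto the dark state, with its entries written out. -/
theorem vecMulVec_dfsState {r : ℝ} (hr : 0 < r) (θ : ℝ) :
    vecMulVec (dfsState r θ) (star (dfsState r θ)) =
      !![((Real.exp (-r) * Real.cosh r : ℝ) : ℂ),
          ((Real.exp (-r) * √(Real.cosh r) * √(Real.sinh r) : ℝ) : ℂ)
            * Complex.exp (-(Complex.I * θ) / 2);
        ((Real.exp (-r) * √(Real.cosh r) * √(Real.sinh r) : ℝ) : ℂ)
            * Complex.exp ((Complex.I * θ) / 2),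
          ((Real.exp (-r) * Real.sinh r : ℝ) : ℂ)] := by
  have he : (Real.exp (-r) : ℂ) = (Real.exp (-r / 2) : ℂ) * (Real.exp (-r / 2) : ℂ) := by
    rw [← Complex.ofReal_mul, ← Real.exp_add, add_halves]
  have hc : (Real.cosh r : ℂ) = (√(Real.cosh r) : ℂ) * (√(Real.cosh r) : ℂ) := by
    rw [← Complex.ofReal_mul, Real.mul_self_sqrt (Real.cosh_pos r).le]
  have hs : (Real.sinh r : ℂ) = (√(Real.sinh r) : ℂ) * (√(Real.sinh r) : ℂ) := by
    rw [← Complex.ofReal_mul, Real.mul_self_sqrt (Real.sinh_pos_iff.2 hr).le]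
  have hv := conj_exp_I_mul_half θ
  have huv := exp_I_mul_half_mul_exp_neg θ
  ext i j
  fin_cases i <;> fin_cases j <;>
    simp only [vecMulVec_apply, dfsState, Pi.star_apply, Matrix.of_apply, Matrix.cons_val',
      Matrix.cons_val_zero, Matrix.cons_val_one, Matrix.cons_val_fin_one, Fin.zero_eta, Fin.mk_one,
      Complex.star_def, map_mul, Complex.conj_ofReal, hv, Complex.ofReal_mul]
  · rw [he, hc]; ring
  · rw [he]; ring
  · rw [he]; ring
  · rw [he, hs]
    linear_combination ((Real.exp (-r / 2) : ℂ) ^ 2 * (√(Real.sinh r) : ℂ) ^ 2) * huv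

/-- The right-hand side of the Lindblad equation at the dark state, with `a = √(cosh r)`,
`b = √(sinh r)`, `E = e^{-r}`, `u = e^{iθ/2}`, `v = e^{-iθ/2}`, under the control field
`Ω = (X + iY) v`. -/
theorem lindblad_rhs_eq {γ E a b r' θ' X Y Q : ℝ} {u v : ℂ} (huv : u * v = 1)
    (hab : a * b ≠ 0) (hE : E = a ^ 2 - b ^ 2)
    (hX : 2 * E * X = -(θ' * (a * b)))
    (hY : 2 * (a * b) * Y = -(E * (r' + γ * (a * b) ^ 2)))
    (hQ : 2 * (a * b) * Q = r' * E ^ 3)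
    {L H ρ : Matrix (Fin 2) (Fin 2) ℂ}
    (hL : L = !![0, (a : ℂ) ^ 2 * v; (b : ℂ) ^ 2 * u, 0])
    (hLs : Lᴴ = !![0, (b : ℂ) ^ 2 * v; (a : ℂ) ^ 2 * u, 0])
    (hH : H = !![0, (X + Complex.I * Y) * v; (X - Complex.I * Y) * u, 0])
    (hρ : ρ = !![(E : ℂ) * a ^ 2, E * a * b * v; E * a * b * u, E * b ^ 2]) :
    (-Complex.I) • (H * ρ - ρ * H)
        + (γ : ℂ) • (L * ρ * Lᴴ - (1 / 2 : ℂ) • (Lᴴ * L * ρ + ρ * (Lᴴ * L)))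
      = !![-(r' : ℂ) * E ^ 2, (Q - Complex.I * θ' / 2 * (E * a * b)) * v;
        (Q + Complex.I * θ' / 2 * (E * a * b)) * u, (r' : ℂ) * E ^ 2] := by
  have hab' : (a : ℂ) * b ≠ 0 := by exact_mod_cast hab
  replace hE : (E : ℂ) = a ^ 2 - b ^ 2 := by exact_mod_cast hE
  replace hX : 2 * (E : ℂ) * X = -(θ' * (a * b)) := by exact_mod_cast hX
  replace hY : 2 * ((a : ℂ) * b) * Y = -(E * (r' + γ * (a * b) ^ 2)) := by exact_mod_cast hY
  replace hQ : 2 * ((a : ℂ) * b) * Q = r' * E ^ 3 := by exact_mod_cast hQ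
  have hI := Complex.I_mul_I
  have hQY : (Q : ℂ) = -(E ^ 2 * Y) - γ / 2 * (E ^ 3 * (a * b)) := by
    apply mul_left_cancel₀ hab'
    linear_combination hQ / 2 + E ^ 2 / 2 * hY
  rw [hLs, hL, hH, hρ]
  ext i j
  fin_cases i <;> fin_cases j <;>
    simp
  · linear_combination (-2 * Complex.I ^ 2 * Y * E * a * b
      + γ * E * (a ^ 4 * b ^ 2 - a ^ 2 * b ^ 4)) * huv - 2 * Y * E * a * b * hI + E * hY
      - γ * E * a ^ 2 * b ^ 2 * hE
  · linear_combination γ * E * a * b * (a ^ 2 * b ^ 2 - (a ^ 4 + b ^ 4) / 2) * v * huv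
      - Complex.I * (X + Complex.I * Y) * v * E * hE
      + γ / 2 * E * a * b * (E + a ^ 2 - b ^ 2) * v * hE
      + Complex.I * v * E / 2 * hX + v * Y * E ^ 2 * hI - v * hQY
  · linear_combination γ * E * a * b * (a ^ 2 * b ^ 2 - (a ^ 4 + b ^ 4) / 2) * u * huv
      + Complex.I * (X - Complex.I * Y) * u * E * hE
      + γ / 2 * E * a * b * (E + a ^ 2 - b ^ 2) * u * hE
      - Complex.I * u * E / 2 * hX + u * Y * E ^ 2 * hI - u * hQY
  · linear_combination -(-2 * Complex.I ^ 2 * Y * E * a * b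
      + γ * E * (a ^ 4 * b ^ 2 - a ^ 2 * b ^ 4)) * huv + 2 * Y * E * a * b * hI - E * hY
      + γ * E * a ^ 2 * b ^ 2 * hE

/-- The coherence modulus `e^{-r}√(cosh r)√(sinh r)` along a differentiable path `r`. -/
theorem hasDerivAt_coherence {r : ℝ → ℝ} {r' t : ℝ} (hr : HasDerivAt r r' t) (hpos : 0 < r t) :
    HasDerivAt (fun s => Real.exp (-r s) * √(Real.cosh (r s)) * √(Real.sinh (r s)))
      (r' * Real.exp (-r t) ^ 3 / (2 * (√(Real.cosh (r t)) * √(Real.sinh (r t))))) t := by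
  have hc := Real.cosh_pos (r t)
  have hs := Real.sinh_pos_iff.2 hpos
  have h := (hr.neg.exp.mul (hr.cosh.sqrt hc.ne')).mul (hr.sinh.sqrt hs.ne')
  refine h.congr_deriv ?_
  have hE : Real.exp (-r t) = √(Real.cosh (r t)) ^ 2 - √(Real.sinh (r t)) ^ 2 := by
    rw [Real.sq_sqrt hc.le, Real.sq_sqrt hs.le, Real.cosh_sub_sinh]
  have hc' := Real.sqrt_pos.2 hc
  have hs' := Real.sqrt_pos.2 hs
  have hc2 := Real.sq_sqrt hc.le
  have hs2 := Real.sq_sqrt hs.le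
  simp only [Pi.neg_apply, Pi.mul_apply]
  rw [hE]
  generalize √(Real.cosh (r t)) = a at *
  generalize √(Real.sinh (r t)) = b at *
  rw [← hc2, ← hs2]
  field_simp
  ring

/-- for differentiable reservoir parameters `r(t) > 0`, `θ(t)`, there is
an off-diagonal Hermitian control Hamiltonian `H(t) = Ω(t)e₀e₁† + Ω̄(t)e₁e₀†` such that
`ρ(t) = ψ(t)ψ(t)†` (with `ψ(t)` the normalized eigenvector of `L(t)`) solves the
Lindblad master equation; consequently `Tr(ρ(t)²) = 1` for all `t`. -/
theorem two_level_dfs_engineering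
    (γ : ℝ) (hγ : 0 ≤ γ) (r θ : ℝ → ℝ)
    (hr : Differentiable ℝ r) (hθ : Differentiable ℝ θ)
    (hrpos : ∀ t, 0 < r t) :
    ∃ Ω : ℝ → ℂ,
      (∀ (t : ℝ) (i j : Fin 2), HasDerivAt
        (fun s => vecMulVec (dfsState (r s) (θ s)) (star (dfsState (r s) (θ s))) i j)
        (((-Complex.I) • ((Ω t • sigmaMinus + (starRingEnd ℂ (Ω t)) • sigmaPlus)
              * vecMulVec (dfsState (r t) (θ t)) (star (dfsState (r t) (θ t)))
            - vecMulVec (dfsState (r t) (θ t)) (star (dfsState (r t) (θ t)))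
              * (Ω t • sigmaMinus + (starRingEnd ℂ (Ω t)) • sigmaPlus))
          + (γ : ℂ) • (squeezedL (r t) (θ t)
              * vecMulVec (dfsState (r t) (θ t)) (star (dfsState (r t) (θ t)))
              * (squeezedL (r t) (θ t))ᴴ
            - (1/2 : ℂ) • ((squeezedL (r t) (θ t))ᴴ * squeezedL (r t) (θ t)
                * vecMulVec (dfsState (r t) (θ t)) (star (dfsState (r t) (θ t)))
              + vecMulVec (dfsState (r t) (θ t)) (star (dfsState (r t) (θ t)))
                * ((squeezedL (r t) (θ t))ᴴ * squeezedL (r t) (θ t))))) i j) t)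
      ∧ ∀ t : ℝ,
          (vecMulVec (dfsState (r t) (θ t)) (star (dfsState (r t) (θ t)))
            * vecMulVec (dfsState (r t) (θ t)) (star (dfsState (r t) (θ t)))).trace
          = 1 := by
  have hc (t : ℝ) : 0 < √(Real.cosh (r t)) := Real.sqrt_pos.2 (Real.cosh_pos _)
  have hs (t : ℝ) : 0 < √(Real.sinh (r t)) := Real.sqrt_pos.2 (Real.sinh_pos_iff.2 (hrpos t))
  have hc2 (t : ℝ) : √(Real.cosh (r t)) ^ 2 = Real.cosh (r t) :=
    Real.sq_sqrt (Real.cosh_pos _).le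
  have hs2 (t : ℝ) : √(Real.sinh (r t)) ^ 2 = Real.sinh (r t) :=
    Real.sq_sqrt (Real.sinh_pos_iff.2 (hrpos t)).le
  have hE (t : ℝ) : Real.exp (-r t) = √(Real.cosh (r t)) ^ 2 - √(Real.sinh (r t)) ^ 2 := by
    rw [hc2, hs2, Real.cosh_sub_sinh]
  have hab (t : ℝ) : √(Real.cosh (r t)) * √(Real.sinh (r t)) ≠ 0 := (mul_pos (hc t) (hs t)).ne'
  have hX (t : ℝ) : ∃ X : ℝ, 2 * Real.exp (-r t) * X =
      -(deriv θ t * (√(Real.cosh (r t)) * √(Real.sinh (r t)))) :=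
    ⟨_, mul_div_cancel₀ _ (mul_ne_zero two_ne_zero (Real.exp_ne_zero _))⟩
  have hY (t : ℝ) : ∃ Y : ℝ, 2 * (√(Real.cosh (r t)) * √(Real.sinh (r t))) * Y =
      -(Real.exp (-r t) * (deriv r t + γ * (√(Real.cosh (r t)) * √(Real.sinh (r t))) ^ 2)) :=
    ⟨_, mul_div_cancel₀ _ (mul_ne_zero two_ne_zero (hab t))⟩
  choose X hX using hX
  choose Y hY using hY
  refine ⟨fun t => (X t + Complex.I * Y t) * Complex.exp (-(Complex.I * θ t) / 2),
    fun t i j => ?_, fun t => ?_⟩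
  · have hr' := (hr t).hasDerivAt
    have hθ' := (hθ t).hasDerivAt.ofReal_comp.const_mul Complex.I
    have hu := (hθ'.div_const 2).cexp
    have hv := (hθ'.fun_neg.div_const 2).cexp
    have hq := (hasDerivAt_coherence hr' (hrpos t)).ofReal_comp
    have hp := (hr'.fun_neg.exp.fun_mul hr'.cosh).ofReal_comp
    have hm := (hr'.fun_neg.exp.fun_mul hr'.sinh).ofReal_comp
    have hL : squeezedL (r t) (θ t) =
        !![0, (√(Real.cosh (r t)) : ℂ) ^ 2 * Complex.exp (-(Complex.I * θ t) / 2);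
          (√(Real.sinh (r t)) : ℂ) ^ 2 * Complex.exp ((Complex.I * θ t) / 2), 0] := by
      rw [← Complex.ofReal_pow, ← Complex.ofReal_pow, hc2, hs2]
      ext i j
      fin_cases i <;> fin_cases j <;> simp [squeezedL, sigmaMinus, sigmaPlus]
    have hLs : (squeezedL (r t) (θ t))ᴴ =
        !![0, (√(Real.sinh (r t)) : ℂ) ^ 2 * Complex.exp (-(Complex.I * θ t) / 2);
          (√(Real.cosh (r t)) : ℂ) ^ 2 * Complex.exp ((Complex.I * θ t) / 2), 0] := by
      rw [hL]
      ext i j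
      fin_cases i <;> fin_cases j <;>
        simp [conj_exp_I_mul_half, conj_exp_neg_I_mul_half]
    rw [lindblad_rhs_eq (exp_I_mul_half_mul_exp_neg (θ t)) (hab t) (hE t) (hX t) (hY t)
      (mul_div_cancel₀ _ (mul_ne_zero two_ne_zero (hab t))) hL hLs
      (by ext i j; fin_cases i <;> fin_cases j <;>
            simp [sigmaMinus, sigmaPlus, conj_exp_neg_I_mul_half, sub_eq_add_neg])
      (by rw [vecMulVec_dfsState (hrpos t)]
          simp only [Complex.ofReal_mul, ← Complex.ofReal_pow, hc2, hs2])]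
    simp only [vecMulVec_dfsState (hrpos _)]
    fin_cases i <;> fin_cases j
    · refine hp.congr_deriv ?_
      change _ = -((deriv r t : ℝ) : ℂ) * (Real.exp (-r t) : ℂ) ^ 2
      have h : Real.exp (-r t) * -deriv r t * Real.cosh (r t)
          + Real.exp (-r t) * (Real.sinh (r t) * deriv r t)
          = -deriv r t * Real.exp (-r t) ^ 2 := by
        linear_combination deriv r t * Real.exp (-r t) * Real.cosh_sub_sinh (r t) * (-1)
      exact_mod_cast h
    · refine (hq.fun_mul hv).congr_deriv ?_
      simp only [Fin.zero_eta, Fin.mk_one, of_apply, cons_val', cons_val_zero, cons_val_one,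
        cons_val_fin_one, Complex.ofReal_mul]
      ring
    · refine (hq.fun_mul hu).congr_deriv ?_
      simp only [Fin.zero_eta, Fin.mk_one, of_apply, cons_val', cons_val_zero, cons_val_one,
        cons_val_fin_one, Complex.ofReal_mul]
      ring
    · refine hm.congr_deriv ?_
      change _ = ((deriv r t : ℝ) : ℂ) * (Real.exp (-r t) : ℂ) ^ 2
      have h : Real.exp (-r t) * -deriv r t * Real.sinh (r t)
          + Real.exp (-r t) * (Real.cosh (r t) * deriv r t)
          = deriv r t * Real.exp (-r t) ^ 2 := by
        linear_combination deriv r t * Real.exp (-r t) * Real.cosh_sub_sinh (r t)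
      exact_mod_cast h
  · have huv := exp_I_mul_half_mul_exp_neg (θ t)
    have hsum : (Real.exp (-r t) : ℂ)
        * ((√(Real.cosh (r t)) : ℂ) ^ 2 + (√(Real.sinh (r t)) : ℂ) ^ 2) = 1 := by
      rw [← Complex.ofReal_pow, ← Complex.ofReal_pow, hc2, hs2, ← Complex.ofReal_add,
        Real.cosh_add_sinh, ← Complex.ofReal_mul, ← Real.exp_add, neg_add_cancel, Real.exp_zero,
        Complex.ofReal_one]
    have hc2' : (Real.cosh (r t) : ℂ) = (√(Real.cosh (r t)) : ℂ) ^ 2 := by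
      rw [← Complex.ofReal_pow, hc2]
    have hs2' : (Real.sinh (r t) : ℂ) = (√(Real.sinh (r t)) : ℂ) ^ 2 := by
      rw [← Complex.ofReal_pow, hs2]
    rw [vecMulVec_dfsState (hrpos t)]
    simp only [Complex.ofReal_mul, hc2', hs2']
    generalize (√(Real.cosh (r t)) : ℂ) = a at *
    generalize (√(Real.sinh (r t)) : ℂ) = b at *
    generalize (Real.exp (-r t) : ℂ) = E at *
    simp only [trace_fin_two, mul_apply, Fin.sum_univ_two, of_apply, cons_val', cons_val_zero,
      cons_val_one, cons_val_fin_one]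
    linear_combination 2 * E ^ 2 * a ^ 2 * b ^ 2 * huv + (E * (a ^ 2 + b ^ 2) + 1) * hsum
end

section
/- Let μ > 0, γ ≥ 0, and ε ∈ ℝ, and define for t > 0 the adjusted coherent control field strength |Ω'(t)| = e^{−μt} (μ + γ sinh(μt) cosh(μt)) / (2 √(sinh(μt + ε) cosh(μt))). Then lim_{t → ∞} |Ω'(t)| = (γ/4) e^{−ε/2}. -/
open Filter Real

/-- The control field strength as a function of `y = exp (-s)`, which is regular at `y = 0`. -/
lemma control_field_eq_of_exp_neg (μ γ ε s : ℝ) :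
    exp (-s) * (μ + γ * sinh s * cosh s) / (2 * √(sinh (s + ε) * cosh s)) =
      (μ * exp (-s) ^ 2 + γ * (1 - exp (-s) ^ 4) / 4) /
        (2 * √((exp ε - exp (-ε) * exp (-s) ^ 2) * (1 + exp (-s) ^ 2) / 4)) := by
  have hy : 0 < exp (-s) := exp_pos _
  have hs : exp s = (exp (-s))⁻¹ := by rw [exp_neg, inv_inv]
  have hsinh : sinh (s + ε) * cosh s =
      ((exp ε - exp (-ε) * exp (-s) ^ 2) * (1 + exp (-s) ^ 2) / 4) / exp (-s) ^ 2 := by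
    rw [sinh_eq, cosh_eq, neg_add, exp_add, exp_add, hs]
    field_simp
    ring
  have hnum : exp (-s) * (μ + γ * sinh s * cosh s) =
      (μ * exp (-s) ^ 2 + γ * (1 - exp (-s) ^ 4) / 4) / exp (-s) := by
    rw [sinh_eq, cosh_eq, hs]
    field_simp
    ring
  rw [hsinh, hnum, sqrt_div' _ (sq_nonneg _), sqrt_sq hy.le, ← mul_div_assoc,
    div_div_div_cancel_right₀ hy.ne']

/-- the adjusted control field strength
`|Ω'(t)| = e^{−μt}(μ + γ sinh(μt)cosh(μt)) / (2√(sinh(μt+ε)cosh(μt)))`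
tends to `(γ/4) e^{−ε/2}` as `t → ∞`. -/
theorem adjusted_control_field_limit (μ γ ε : ℝ) (hμ : 0 < μ) (hγ : 0 ≤ γ) :
    Tendsto (fun t : ℝ =>
        Real.exp (-(μ * t)) * (μ + γ * Real.sinh (μ * t) * Real.cosh (μ * t))
          / (2 * Real.sqrt (Real.sinh (μ * t + ε) * Real.cosh (μ * t))))
      atTop (nhds (γ / 4 * Real.exp (-ε / 2))) := by
  simp_rw [control_field_eq_of_exp_neg]
  have hexp : Tendsto (fun t : ℝ => exp (-(μ * t))) atTop (nhds 0) :=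
    tendsto_exp_neg_atTop_nhds_zero.comp (tendsto_id.const_mul_atTop hμ)
  have hsqrt : √(exp ε / 4) = exp (ε / 2) / 2 := by
    rw [sqrt_eq_iff_mul_self_eq (by positivity) (by positivity), div_mul_div_comm, ← exp_add]
    norm_num
  have hcont : ContinuousAt (fun y : ℝ => (μ * y ^ 2 + γ * (1 - y ^ 4) / 4) /
      (2 * √((exp ε - exp (-ε) * y ^ 2) * (1 + y ^ 2) / 4))) 0 := by
    refine ContinuousAt.div (by fun_prop) (by fun_prop) ?_
    simp [(sqrt_pos.2 (exp_pos ε)).ne']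
  have hvalue : γ / 4 * exp (-ε / 2) = (μ * 0 ^ 2 + γ * (1 - 0 ^ 4) / 4) /
      (2 * √((exp ε - exp (-ε) * 0 ^ 2) * (1 + 0 ^ 2) / 4)) := by
    rw [show (exp ε - exp (-ε) * 0 ^ 2) * (1 + 0 ^ 2) / 4 = exp ε / 4 by ring, hsqrt, neg_div,
      exp_neg]
    field_simp
    ring
  rw [hvalue]
  exact hcont.tendsto.comp hexp
end
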